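/- For integers k, ℓ ≥ 0, define J_{k,ℓ} = ∬_{[-1,1]²} Ĉ_k(x)² Ĉ_ℓ(y)² w(x) w(y) log(1/(2|x-y|)) dx dy, with w(x) = 1/(π√(1-x²)). Then J_{k,k} = 1/(4k) for every k ≥ 1, and J_{k,ℓ} = 0 for every other choice of k and ℓ (i.e., whenever k ≠ ℓ, and also when k = ℓ = 0). -/

import Mathlib

open Real MeasureTheory Finset

/-- Normalized Chebyshev polynomials of the first kind:
`Ĉ_0 = 1`, `Ĉ_j = √2 · T_j` for `j ≥ 1`. -/
noncomputable def Chat (j : ℕ) (x : ℝ) : ℝ :=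
  if j = 0 then 1 else Real.sqrt 2 * (Polynomial.Chebyshev.T ℝ (j : ℤ)).eval x

/-- The Chebyshev weight `w(x) = 1/(π√(1-x²))`. -/
noncomputable def w0 (x : ℝ) : ℝ := 1 / (Real.pi * Real.sqrt (1 - x ^ 2))

/-- `J_{k,ℓ} = ∬ Ĉ_k(x)² Ĉ_ℓ(y)² w(x) w(y) log(1/(2|x-y|)) dx dy`. -/
noncomputable def J (k l : ℕ) : ℝ :=
  ∫ x in Set.Icc (-1 : ℝ) 1, ∫ y in Set.Icc (-1 : ℝ) 1,
    Chat k x ^ 2 * Chat l y ^ 2 * w0 x * w0 y * Real.log (1 / (2 * |x - y|))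

open intervalIntegral in
lemma aux_int_cos (m : ℤ) (hm : m ≠ 0) : ∫ u in (0:ℝ)..π, Real.cos (m * u) = 0 := by
  have hm' : (m : ℝ) ≠ 0 := by exact_mod_cast hm
  rw [intervalIntegral.integral_comp_mul_left (fun u => Real.cos u) hm']
  simp [Real.sin_int_mul_pi]

noncomputable def auxL (u : ℝ) : ℝ := Real.log (2 * Real.sin (u / 2))

noncomputable def auxV (n : ℕ) (u : ℝ) : ℝ := ∑ j ∈ Finset.range n, Real.cos ((j + 1 / 2) * u)

lemma auxV_cont (n : ℕ) : Continuous (auxV n) := by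
  unfold auxV; fun_prop

lemma auxV_sin (n : ℕ) (u : ℝ) : Real.sin (n * u) = 2 * Real.sin (u / 2) * auxV n u := by
  induction n with
  | zero => simp [auxV]
  | succ n ih =>
    have h : auxV (n + 1) u = auxV n u + Real.cos ((n + 1 / 2) * u) := by
      simp [auxV, Finset.sum_range_succ]
    rw [h, mul_add, ← ih]
    have e1 : ((n + 1 : ℕ) : ℝ) * u = (n + 1 / 2) * u + u / 2 := by push_cast; ring
    have e2 : (n : ℝ) * u = (n + 1 / 2) * u - u / 2 := by ring
    rw [e1, e2, Real.sin_add, Real.sin_sub]; ring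

lemma auxV_int (n : ℕ) : ∫ u in (0:ℝ)..π, auxV (n + 1) u * Real.cos (u / 2) = π / 2 := by
  induction n with
  | zero =>
    have : ∀ u : ℝ, auxV (0 + 1) u * Real.cos (u / 2) = 1 / 2 + (1 / 2) * Real.cos ((1 : ℤ) * u) := by
      intro u
      have e : Real.cos u = 2 * Real.cos (u / 2) ^ 2 - 1 := by
        rw [← Real.cos_two_mul]; congr 1; ring
      have e' : (1 / 2 : ℝ) * u = u / 2 := by ring
      simp only [auxV, Finset.sum_range_succ, Finset.sum_range_zero]
      push_cast
      rw [one_mul, e, zero_add, zero_add, e']; ring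
    simp_rw [this]
    rw [intervalIntegral.integral_add (by simp) (Continuous.intervalIntegrable (by fun_prop) _ _),
      intervalIntegral.integral_const_mul, aux_int_cos 1 (by norm_num)]
    simp; ring
  | succ n ih =>
    have : ∀ u : ℝ, auxV (n + 1 + 1) u * Real.cos (u / 2) = auxV (n + 1) u * Real.cos (u / 2) +
        ((1 / 2) * Real.cos (((n + 1 : ℕ) : ℤ) * u) + (1 / 2) * Real.cos (((n + 2 : ℕ) : ℤ) * u)) := by
      intro u
      have h : auxV (n + 1 + 1) u = auxV (n + 1) u + Real.cos (((n + 1 : ℕ) + 1 / 2) * u) := by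
        simp only [auxV, Finset.sum_range_succ _ (n + 1)]
      have e1 : (((n + 1 : ℕ) : ℤ) : ℝ) * u = ((n + 1 : ℕ) + 1 / 2) * u - u / 2 := by push_cast; ring
      have e2 : (((n + 2 : ℕ) : ℤ) : ℝ) * u = ((n + 1 : ℕ) + 1 / 2) * u + u / 2 := by push_cast; ring
      rw [h, e1, e2, Real.cos_sub, Real.cos_add]; ring
    simp_rw [this]
    have hc := auxV_cont (n + 1)
    rw [intervalIntegral.integral_add (Continuous.intervalIntegrable (by fun_prop) _ _)
        (Continuous.intervalIntegrable (by fun_prop) _ _), ih,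
      intervalIntegral.integral_add (Continuous.intervalIntegrable (by fun_prop) _ _)
        (Continuous.intervalIntegrable (by fun_prop) _ _),
      intervalIntegral.integral_const_mul, intervalIntegral.integral_const_mul,
      aux_int_cos _ (by omega), aux_int_cos _ (by omega)]
    simp

lemma auxL_ii (a b : ℝ) : IntervalIntegrable auxL volume a b := by
  have : auxL = Real.log ∘ (fun u => 2 * Real.sin (u / 2)) := rfl
  rw [this]
  apply MeromorphicOn.intervalIntegrable_log
  intro x _
  apply AnalyticAt.meromorphicAt
  fun_prop

lemma auxL_even (u : ℝ) : auxL (-u) = auxL u := by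
  unfold auxL
  rw [neg_div, Real.sin_neg, mul_neg, Real.log_neg_eq_log]

lemma auxL_per (u : ℝ) : auxL (u + 2 * π) = auxL u := by
  unfold auxL
  have : (u + 2 * π) / 2 = u / 2 + π := by ring
  rw [this, Real.sin_add_pi, mul_neg, Real.log_neg_eq_log]

lemma auxL_mul_ii (f : ℝ → ℝ) (hf : Continuous f) (a b : ℝ) :
    IntervalIntegrable (fun u => f u * auxL u) volume a b :=
  (auxL_ii a b).continuousOn_mul hf.continuousOn

lemma aux_half (n : ℕ) : ∫ u in (0:ℝ)..π, Real.cos (n * u) * auxL u = -π / (2 * n) := by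
  rcases n with _ | n
  · simp only [Nat.cast_zero, zero_mul, Real.cos_zero, one_mul, mul_zero, div_zero]
    have h := intervalIntegral.integral_comp_div (a := 0) (b := π)
      (fun u => Real.log (2 * Real.sin u)) (two_ne_zero : (2:ℝ) ≠ 0)
    unfold auxL
    rw [h]
    have h2 : ∫ u in (0/2:ℝ)..(π/2), Real.log (2 * Real.sin u)
        = ∫ u in (0:ℝ)..(π/2), (Real.log 2 + Real.log (Real.sin u)) := by
      rw [zero_div]
      apply intervalIntegral.integral_congr_ae
      refine Filter.Eventually.of_forall fun u hu => ?_
      rw [Set.uIoc_of_le (by positivity)] at hu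
      have : 0 < Real.sin u := Real.sin_pos_of_pos_of_lt_pi hu.1 (by linarith [hu.2, Real.pi_pos])
      rw [Real.log_mul (by norm_num) this.ne']
    rw [h2, intervalIntegral.integral_add (by simp) (by exact intervalIntegrable_log_sin),
      integral_log_sin_zero_pi_div_two]
    simp; ring
  · set N := n + 1 with hN
    have hN0 : (N : ℝ) ≠ 0 := by positivity
    have hVc := auxV_cont N
    have key : ∫ u in (0:ℝ)..π, (N * (Real.cos (N * u) * auxL u) + auxV N u * Real.cos (u / 2))
        = Real.sin (N * π) * auxL π - Real.sin (N * 0) * auxL 0 := by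
      refine intervalIntegral.integral_eq_sub_of_hasDerivAt_of_le (f := fun u => Real.sin (N * u) * auxL u)
        Real.pi_pos.le ?_ ?_ ?_
      · apply Continuous.continuousOn
        have : (fun u => Real.sin (N * u) * auxL u) = fun u =>
            auxV N u * ((2 * Real.sin (u / 2)) * Real.log (2 * Real.sin (u / 2))) := by
          funext u; rw [auxV_sin, auxL]; ring
        rw [this]
        exact hVc.mul (Real.continuous_mul_log.comp (by fun_prop : Continuous fun u : ℝ => 2 * Real.sin (u / 2)))
      · intro u hu
        have hs : 0 < Real.sin (u / 2) := Real.sin_pos_of_pos_of_lt_pi (by linarith [hu.1]) (by linarith [hu.1, hu.2])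
        have h1 : HasDerivAt (fun u : ℝ => Real.sin (N * u)) (Real.cos (N * u) * (N * 1)) u :=
          ((hasDerivAt_id u).const_mul (N : ℝ)).sin
        have h2 : HasDerivAt auxL ((2 * (Real.cos (u / 2) * (1 / 2))) / (2 * Real.sin (u / 2))) u :=
          ((((hasDerivAt_id u).div_const 2).sin).const_mul 2).log (by simpa using hs.ne')
        refine (h1.mul h2).congr_deriv ?_
        rw [auxV_sin]
        field_simp
      · exact ((auxL_mul_ii _ (by fun_prop) _ _).const_mul _).add
          (Continuous.intervalIntegrable (by fun_prop) _ _)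
    rw [intervalIntegral.integral_add ((auxL_mul_ii _ (by fun_prop) _ _).const_mul _)
          (Continuous.intervalIntegrable (by fun_prop) _ _), auxV_int,
        intervalIntegral.integral_const_mul, Real.sin_nat_mul_pi] at key
    simp only [mul_zero, Real.sin_zero, zero_mul, sub_zero] at key
    field_simp
    linarith

lemma aux_full (n : ℕ) : ∫ u in (-π)..π, Real.cos (n * u) * auxL u = -π / n := by
  rw [← intervalIntegral.integral_add_adjacent_intervals (b := 0)
    (auxL_mul_ii _ (by fun_prop) _ _) (auxL_mul_ii _ (by fun_prop) _ _)]
  have h := intervalIntegral.integral_comp_neg (a := 0) (b := π) (fun u => Real.cos (n * u) * auxL u)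
  simp only [mul_neg, Real.cos_neg, auxL_even, neg_zero] at h
  rw [← h, aux_half]
  rcases n with _ | n
  · simp
  · field_simp; ring

lemma aux_full_sin (n : ℕ) : ∫ u in (-π)..π, Real.sin (n * u) * auxL u = 0 := by
  have h := intervalIntegral.integral_comp_neg (a := -π) (b := π) (fun u => Real.sin (n * u) * auxL u)
  simp only [mul_neg, Real.sin_neg, auxL_even, neg_neg, neg_mul, intervalIntegral.integral_neg] at h
  linarith

lemma auxL_shift_ii (θ a b : ℝ) : IntervalIntegrable (fun u => auxL (θ + u)) volume a b := by
  have : (fun u => auxL (θ + u)) = Real.log ∘ (fun u => 2 * Real.sin ((θ + u) / 2)) := rfl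
  rw [this]
  apply MeromorphicOn.intervalIntegrable_log
  intro x _
  apply AnalyticAt.meromorphicAt
  fun_prop

lemma auxL_shift_ii' (θ a b : ℝ) : IntervalIntegrable (fun u => auxL (θ - u)) volume a b := by
  have : (fun u => auxL (θ - u)) = Real.log ∘ (fun u => 2 * Real.sin ((θ - u) / 2)) := rfl
  rw [this]
  apply MeromorphicOn.intervalIntegrable_log
  intro x _
  apply AnalyticAt.meromorphicAt
  fun_prop

lemma aux_K (n : ℕ) (θ : ℝ) :
    ∫ φ in (0:ℝ)..π, Real.cos (n * φ) * (auxL (θ + φ) + auxL (θ - φ)) = -π * Real.cos (n * θ) / n := by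
  have i1 : ∀ a b, IntervalIntegrable (fun φ => Real.cos (n * φ) * auxL (θ + φ)) volume a b :=
    fun a b => (auxL_shift_ii θ a b).continuousOn_mul (Continuous.continuousOn (by fun_prop))
  have i2 : ∀ a b, IntervalIntegrable (fun φ => Real.cos (n * φ) * auxL (θ - φ)) volume a b :=
    fun a b => (auxL_shift_ii' θ a b).continuousOn_mul (Continuous.continuousOn (by fun_prop))
  simp_rw [mul_add]
  rw [intervalIntegral.integral_add (i1 _ _) (i2 _ _)]
  have h := intervalIntegral.integral_comp_neg (a := 0) (b := π)
    (fun u => Real.cos (n * u) * auxL (θ + u))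
  simp only [mul_neg, Real.cos_neg, neg_zero, ← sub_eq_add_neg] at h
  rw [h, add_comm, intervalIntegral.integral_add_adjacent_intervals (i1 _ _) (i1 _ _)]
  have h3 : ∀ u : ℝ, Real.cos (n * u) * auxL (θ + u)
      = (fun v => Real.cos (n * (v - θ)) * auxL v) (θ + u) := by
    intro u; simp
  simp_rw [h3]
  rw [intervalIntegral.integral_comp_add_left (fun v => Real.cos (n * (v - θ)) * auxL v)]
  have hp : Function.Periodic (fun v => Real.cos (n * (v - θ)) * auxL v) (2 * π) := by
    intro v
    simp only [auxL_per]
    congr 1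
    rw [← Real.cos_add_nat_mul_two_pi (n * (v - θ)) n]; congr 1; ring
  have h4 := hp.intervalIntegral_add_eq (θ + -π) (-π)
  rw [show θ + -π + 2 * π = θ + π by ring, show -π + 2 * π = π by ring] at h4
  rw [h4]
  have h5 : ∀ v : ℝ, Real.cos (n * (v - θ)) * auxL v =
      Real.cos (n * θ) * (Real.cos (n * v) * auxL v) + Real.sin (n * θ) * (Real.sin (n * v) * auxL v) := by
    intro v; rw [mul_sub, Real.cos_sub]; ring
  simp_rw [h5]
  rw [intervalIntegral.integral_add ((auxL_mul_ii _ (by fun_prop) _ _).const_mul _)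
    ((auxL_mul_ii _ (by fun_prop) _ _).const_mul _), intervalIntegral.integral_const_mul,
    intervalIntegral.integral_const_mul, aux_full, aux_full_sin]
  ring

lemma aux_log (θ φ : ℝ) (hθ : θ ∈ Set.Icc 0 π) (hφ : φ ∈ Set.Icc 0 π) (h : φ ≠ θ) :
    Real.log (1 / (2 * |Real.cos θ - Real.cos φ|)) = -(auxL (θ + φ) + auxL (θ - φ)) := by
  have hne : Real.cos θ - Real.cos φ ≠ 0 := fun h0 =>
    h (Real.injOn_cos hφ hθ (by linarith))
  have e : Real.cos θ - Real.cos φ = -2 * Real.sin ((θ + φ) / 2) * Real.sin ((θ - φ) / 2) :=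
    Real.cos_sub_cos θ φ
  have h1 : Real.sin ((θ + φ) / 2) ≠ 0 := by
    intro h0; rw [e, h0] at hne; simp at hne
  have h2 : Real.sin ((θ - φ) / 2) ≠ 0 := by
    intro h0; rw [e, h0] at hne; simp at hne
  unfold auxL
  rw [← Real.log_mul (by simpa using h1) (by simpa using h2), one_div, Real.log_inv,
    
    ← Real.log_abs (2 * Real.sin ((θ + φ) / 2) * (2 * Real.sin ((θ - φ) / 2))), e]
  congr 2
  simp [abs_mul]; ring

lemma aux_Chat (l : ℕ) (φ : ℝ) :
    Chat l (Real.cos φ) ^ 2 = 1 + (if l = 0 then 0 else Real.cos ((2 * l : ℕ) * φ)) := by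
  unfold Chat
  split_ifs
  · simp
  · rw [Polynomial.Chebyshev.T_real_cos, mul_pow, Real.sq_sqrt (by norm_num)]
    push_cast
    rw [mul_assoc 2, Real.cos_two_mul]; ring

lemma aux_subst (g : ℝ → ℝ) :
    ∫ x in Set.Icc (-1 : ℝ) 1, g x * w0 x = (1 / π) * ∫ θ in (0:ℝ)..π, g (Real.cos θ) := by
  rw [← Polynomial.Chebyshev.integral_measureT_eq_integral_cos (f := g),
    Polynomial.Chebyshev.integral_measureT, ← intervalIntegral.integral_const_mul,
    intervalIntegral.integral_of_le (by norm_num), MeasureTheory.integral_Icc_eq_integral_Ioc]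
  congr 1
  funext x
  simp only [w0, Real.sqrt_inv, one_div, mul_inv]
  ring

lemma aux_inner (l : ℕ) (θ : ℝ) (hθ : θ ∈ Set.Icc 0 π) :
    ∫ φ in (0:ℝ)..π, Chat l (Real.cos φ) ^ 2 * Real.log (1 / (2 * |Real.cos θ - Real.cos φ|))
      = π * Real.cos ((2 * l : ℕ) * θ) / (2 * l : ℕ) := by
  have h1 : ∫ φ in (0:ℝ)..π, Chat l (Real.cos φ) ^ 2 * Real.log (1 / (2 * |Real.cos θ - Real.cos φ|))
      = ∫ φ in (0:ℝ)..π, -(Real.cos ((0 : ℕ) * φ) * (auxL (θ + φ) + auxL (θ - φ)) +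
        (if l = 0 then 0 else 1) * (Real.cos ((2 * l : ℕ) * φ) * (auxL (θ + φ) + auxL (θ - φ)))) := by
    apply intervalIntegral.integral_congr_ae
    filter_upwards [MeasureTheory.Measure.ae_ne volume θ] with φ hne hφ
    rw [Set.uIoc_of_le Real.pi_pos.le] at hφ
    rw [aux_log θ φ hθ ⟨hφ.1.le, hφ.2⟩ hne, aux_Chat]
    split_ifs <;> simp <;> ring
  have ii : ∀ n : ℕ, IntervalIntegrable
      (fun φ => Real.cos (n * φ) * (auxL (θ + φ) + auxL (θ - φ))) volume 0 π := fun n =>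
    ((auxL_shift_ii θ 0 π).add (auxL_shift_ii' θ 0 π)).continuousOn_mul
      (Continuous.continuousOn (by fun_prop))
  rw [h1, intervalIntegral.integral_neg, intervalIntegral.integral_add (ii 0) ((ii _).const_mul _),
    intervalIntegral.integral_const_mul, aux_K, aux_K]
  split_ifs with h
  · simp [h]
  · simp; ring

lemma aux_J (k l : ℕ) : J k l = (1 / π) * ∫ θ in (0:ℝ)..π,
    Chat k (Real.cos θ) ^ 2 * (Real.cos ((2 * l : ℕ) * θ) / (2 * l : ℕ)) := by
  have h : J k l = ∫ x in Set.Icc (-1 : ℝ) 1, (Chat k x ^ 2 *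
      ((1 / π) * ∫ φ in (0:ℝ)..π, Chat l (Real.cos φ) ^ 2 * Real.log (1 / (2 * |x - Real.cos φ|)))) * w0 x := by
    unfold J
    congr 1
    funext x
    rw [← aux_subst (fun y => Chat l y ^ 2 * Real.log (1 / (2 * |x - y|))),
      mul_right_comm, ← MeasureTheory.integral_const_mul]
    congr 1
    funext y
    ring
  rw [h, aux_subst (fun x => Chat k x ^ 2 *
      ((1 / π) * ∫ φ in (0:ℝ)..π, Chat l (Real.cos φ) ^ 2 * Real.log (1 / (2 * |x - Real.cos φ|))))]
  congr 1
  apply intervalIntegral.integral_congr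
  intro θ hθ
  rw [Set.uIcc_of_le Real.pi_pos.le] at hθ
  simp only
  rw [aux_inner l θ hθ]
  have := Real.pi_ne_zero
  field_simp

lemma aux_J2 (k l : ℕ) (hl : l ≠ 0) : J k l = if k = l then 1 / (4 * (k : ℝ)) else 0 := by
  have hl' : (l : ℝ) ≠ 0 := by exact_mod_cast hl
  rw [aux_J]
  have e : ∀ θ : ℝ, Chat k (Real.cos θ) ^ 2 * (Real.cos ((2 * l : ℕ) * θ) / (2 * l : ℕ)) =
      (1 / (2 * l : ℝ)) * Real.cos (((2 * l : ℕ) : ℤ) * θ) + (if k = 0 then 0 else 1 / (4 * l : ℝ)) *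
      (Real.cos (((2 * k - 2 * l : ℤ)) * θ) + Real.cos (((2 * k + 2 * l : ℤ)) * θ)) := by
    intro θ
    rw [aux_Chat]
    push_cast
    rw [sub_mul, add_mul (2 * (k:ℝ)), Real.cos_sub, Real.cos_add]
    split_ifs
    · field_simp; ring
    · field_simp; ring
  simp_rw [e]
  rw [intervalIntegral.integral_add (Continuous.intervalIntegrable (by fun_prop) _ _)
      (Continuous.intervalIntegrable (by fun_prop) _ _), intervalIntegral.integral_const_mul,
      intervalIntegral.integral_const_mul,
      intervalIntegral.integral_add (Continuous.intervalIntegrable (by fun_prop) _ _)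
      (Continuous.intervalIntegrable (by fun_prop) _ _),
      aux_int_cos _ (by omega), aux_int_cos (2 * k + 2 * l) (by omega)]
  by_cases hkl : k = l
  · subst hkl
    have := Real.pi_ne_zero
    simp [hl]
    field_simp
  · rw [aux_int_cos _ (by omega)]
    simp [hkl]

theorem chebyshev_J_integral :
    (∀ k : ℕ, 1 ≤ k → J k k = 1 / (4 * (k : ℝ))) ∧
    (∀ k l : ℕ, k ≠ l → J k l = 0) ∧ J 0 0 = 0 := by
  have h0 : ∀ k, J k 0 = 0 := fun k => by rw [aux_J]; simp
  refine ⟨fun k hk => ?_, fun k l hkl => ?_, h0 0⟩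
  · rw [aux_J2 k k (by omega), if_pos rfl]
  · by_cases hl : l = 0
    · rw [hl, h0]
    · rw [aux_J2 k l hl, if_neg hkl]
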